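/- Let p > 1 and let Ω ⊂ ℝ^N be a bounded open set. Suppose ψ : cl(Ω) → ℝ is continuous, is C¹ on Ω with ψ = 0 on ∂Ω, its flux V_ψ is continuously differentiable on Ω, and div V_ψ(x) = −1 for all x ∈ Ω (i.e. ψ is the p-torsion function of Ω). If x₁ ∈ ℝ^N and d > 0 are such that Ω is contained in the ball B_d(x₁), then for every x ∈ Ω, ψ(x) ≤ ((p−1)/p)·N^{−1/(p−1)}·(d^{p/(p−1)} − ‖x − x₁‖^{p/(p−1)}); in particular sup_Ω ψ ≤ ((p−1)/p)·N^{−1/(p−1)}·d^{p/(p−1)}. -/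

import Mathlib

open Real Set Metric MeasureTheory

/-- The "flux" of `u` at `x`: `‖∇u(x)‖^(p-2) ∇u(x)` (equal to `0` when `∇u(x) = 0`,
by the junk-value conventions of `Real.rpow`, since `p ≠ 2` gives `0 ^ (p-2) = 0` and
for `p = 2` the scalar multiplies the zero vector). -/
noncomputable def flux {N : ℕ} (p : ℝ) (u : EuclideanSpace ℝ (Fin N) → ℝ)
    (x : EuclideanSpace ℝ (Fin N)) : EuclideanSpace ℝ (Fin N) :=
  ‖gradient u x‖ ^ (p - 2) • gradient u x

/-- The divergence of a vector field `V` at `x`: `∑ i, ∂V_i/∂x_i (x)`. -/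
noncomputable def pdiv {N : ℕ} (V : EuclideanSpace ℝ (Fin N) → EuclideanSpace ℝ (Fin N))
    (x : EuclideanSpace ℝ (Fin N)) : ℝ :=
  ∑ i : Fin N, fderiv ℝ V x (EuclideanSpace.single i 1) i

open scoped Gradient Topology

theorem hasDerivAt_max_zero_sq (t : ℝ) :
    HasDerivAt (fun s : ℝ => max s 0 ^ 2) (2 * max t 0) t := by
  rcases lt_trichotomy t 0 with ht | rfl | ht
  · rw [max_eq_right ht.le, mul_zero]
    refine (hasDerivAt_const t (0 : ℝ)).congr_of_eventuallyEq ?_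
    filter_upwards [Iio_mem_nhds ht] with s hs
    simp [max_eq_right (le_of_lt (mem_Iio.1 hs))]
  · rw [max_self, mul_zero, hasDerivAt_iff_isLittleO_nhds_zero]
    refine Asymptotics.IsBigO.trans_isLittleO (g := fun h : ℝ => h ^ 2) ?_ ?_
    · refine Asymptotics.IsBigO.of_bound 1 (Filter.Eventually.of_forall fun s => ?_)
      rcases le_total s 0 with hs | hs
      · simpa [hs] using sq_nonneg s
      · simp [hs]
    · exact Asymptotics.isLittleO_pow_id one_lt_two
  · rw [max_eq_left ht.le]
    have h := hasDerivAt_pow 2 t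
    simp only [Nat.cast_ofNat, Nat.add_one_sub_one, pow_one] at h
    refine h.congr_of_eventuallyEq ?_
    filter_upwards [Ioi_mem_nhds ht] with s hs
    rw [max_eq_left (le_of_lt (mem_Ioi.1 hs))]

theorem contDiff_max_zero_sq : ContDiff ℝ 1 (fun s : ℝ => max s 0 ^ 2) := by
  rw [contDiff_one_iff_deriv]
  refine ⟨fun t => (hasDerivAt_max_zero_sq t).differentiableAt, ?_⟩
  rw [show deriv (fun s : ℝ => max s 0 ^ 2) = fun t => 2 * max t 0 from
    funext fun t => (hasDerivAt_max_zero_sq t).deriv]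
  fun_prop

/-- A `C¹` function on an open set that vanishes off a compact subset extends by zero
to a `C¹` function on the whole space. -/
theorem contDiff_indicator_of_eq_zero_off_compact {E F : Type*} [NormedAddCommGroup E]
    [NormedSpace ℝ E] [NormedAddCommGroup F] [NormedSpace ℝ F] {Ω K : Set E} {f : E → F}
    (hΩ : IsOpen Ω) (hK : IsCompact K) (hKΩ : K ⊆ Ω) (hf : ContDiffOn ℝ 1 f Ω)
    (h0 : ∀ x ∈ Ω, x ∉ K → f x = 0) : ContDiff ℝ 1 (Ω.indicator f) := by
  rw [contDiff_iff_contDiffAt]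
  intro x
  by_cases hx : x ∈ Ω
  · refine (hf.contDiffAt (hΩ.mem_nhds hx)).congr_of_eventuallyEq ?_
    filter_upwards [hΩ.mem_nhds hx] with y hy using indicator_of_mem hy f
  · refine (contDiffAt_const (c := (0 : F))).congr_of_eventuallyEq ?_
    filter_upwards [hK.isClosed.isOpen_compl.mem_nhds fun h => hx (hKΩ h)] with y hy
    by_cases hyΩ : y ∈ Ω
    · rw [indicator_of_mem hyΩ, h0 y hyΩ hy]
    · exact indicator_of_notMem hyΩ f

theorem continuous_pdiv {N : ℕ} {V : EuclideanSpace ℝ (Fin N) → EuclideanSpace ℝ (Fin N)}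
    (hV : ContDiff ℝ 1 V) : Continuous (pdiv V) := by
  have := hV.continuous_fderiv one_ne_zero
  unfold pdiv
  fun_prop

theorem hasCompactSupport_pdiv {N : ℕ}
    {V : EuclideanSpace ℝ (Fin N) → EuclideanSpace ℝ (Fin N)} (hV : HasCompactSupport V) :
    HasCompactSupport (pdiv V) :=
  HasCompactSupport.intro (hV.fderiv ℝ).isCompact fun x hx => by
    simp [pdiv, image_eq_zero_of_notMem_tsupport hx]

/-- The integral of the divergence of a compactly supported `C¹` field vanishes. -/
theorem integral_pdiv_eq_zero {N : ℕ}
    {V : EuclideanSpace ℝ (Fin N) → EuclideanSpace ℝ (Fin N)}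
    (hV : ContDiff ℝ 1 V) (hc : HasCompactSupport V) : ∫ x, pdiv V x = 0 := by
  have hdV := hV.continuous_fderiv one_ne_zero
  have hint : ∀ i : Fin N,
      Integrable (fun x => fderiv ℝ V x (EuclideanSpace.single i 1)) := fun i =>
    (hdV.clm_apply continuous_const).integrable_of_hasCompactSupport
      (hc.fderiv_apply ℝ _)
  have hzero : ∀ i : Fin N, ∫ x, fderiv ℝ V x (EuclideanSpace.single i 1) = 0 := fun i => by
    have h := integral_smul_fderiv_eq_neg_fderiv_smul_of_integrable (𝕜 := ℝ)
      (μ := (volume : Measure (EuclideanSpace ℝ (Fin N)))) (f := fun _ => (1 : ℝ)) (g := V)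
      (v := EuclideanSpace.single i 1) (by simp) (by simpa using hint i)
      (by simpa using hV.continuous.integrable_of_hasCompactSupport hc)
      (fun _ _ => differentiableAt_const _)
      (fun x _ => hV.differentiable one_ne_zero x)
    simpa using h
  unfold pdiv
  rw [integral_finsetSum]
  · refine Finset.sum_eq_zero fun i _ => ?_
    have h := (EuclideanSpace.proj i : EuclideanSpace ℝ (Fin N) →L[ℝ] ℝ).integral_comp_comm
      (hint i)
    rw [hzero i] at h
    simpa using h
  · exact fun i _ => (EuclideanSpace.proj i : EuclideanSpace ℝ (Fin N) →L[ℝ] ℝ).integrable_comp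
      (hint i)

theorem pdiv_congr_of_eventuallyEq {N : ℕ}
    {V W : EuclideanSpace ℝ (Fin N) → EuclideanSpace ℝ (Fin N)} {x : EuclideanSpace ℝ (Fin N)}
    (h : V =ᶠ[𝓝 x] W) : pdiv V x = pdiv W x := by
  simp only [pdiv, h.fderiv_eq]

theorem pdiv_sub {N : ℕ} {V W : EuclideanSpace ℝ (Fin N) → EuclideanSpace ℝ (Fin N)}
    {x : EuclideanSpace ℝ (Fin N)} (hV : DifferentiableAt ℝ V x)
    (hW : DifferentiableAt ℝ W x) :
    pdiv (fun y => V y - W y) x = pdiv V x - pdiv W x := by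
  simp [pdiv, fderiv_fun_sub hV hW, Finset.sum_sub_distrib]

theorem pdiv_smul {N : ℕ} {h : EuclideanSpace ℝ (Fin N) → ℝ}
    {V : EuclideanSpace ℝ (Fin N) → EuclideanSpace ℝ (Fin N)} {x : EuclideanSpace ℝ (Fin N)}
    (hh : DifferentiableAt ℝ h x) (hV : DifferentiableAt ℝ V x) :
    pdiv (fun y => h y • V y) x = fderiv ℝ h x (V x) + h x * pdiv V x := by
  have hsum : V x = ∑ i : Fin N, V x i • EuclideanSpace.single i (1 : ℝ) := by
    simpa using ((EuclideanSpace.basisFun (Fin N) ℝ).sum_repr (V x)).symm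
  conv_rhs => rw [hsum]
  simp [pdiv, fderiv_fun_smul hh hV, Finset.sum_add_distrib, Finset.mul_sum, mul_comm, add_comm]

/-- Monotonicity of `a ↦ ‖a‖ ^ (p - 2) • a`, with the equality case. -/
theorem inner_sub_norm_rpow_smul_sub {E : Type*} [NormedAddCommGroup E]
    [InnerProductSpace ℝ E] {p : ℝ} (hp : 1 < p) (a b : E) :
    0 ≤ inner ℝ (a - b) (‖a‖ ^ (p - 2) • a - ‖b‖ ^ (p - 2) • b) ∧
      (inner ℝ (a - b) (‖a‖ ^ (p - 2) • a - ‖b‖ ^ (p - 2) • b) = 0 → a = b) := by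
  have hpow : ∀ c : E, ‖c‖ ^ (p - 1) = ‖c‖ ^ (p - 2) * ‖c‖ := fun c => by
    rcases eq_or_ne c 0 with rfl | hc
    · simp [zero_rpow (by linarith : p - 1 ≠ 0)]
    · rw [← rpow_add_one (norm_ne_zero_iff.2 hc)]
      ring_nf
  have hp1 : 0 < p - 1 := by linarith
  have hexp : inner ℝ (a - b) (‖a‖ ^ (p - 2) • a - ‖b‖ ^ (p - 2) • b) =
      (‖a‖ - ‖b‖) * (‖a‖ ^ (p - 1) - ‖b‖ ^ (p - 1)) +
        (‖a‖ ^ (p - 2) + ‖b‖ ^ (p - 2)) * (‖a‖ * ‖b‖ - inner ℝ a b) := by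
    rw [hpow, hpow]
    simp only [inner_sub_left, inner_sub_right, inner_smul_right, real_inner_self_eq_norm_sq,
      real_inner_comm a b]
    ring
  have hcs : 0 ≤ ‖a‖ * ‖b‖ - inner ℝ a b := sub_nonneg.2 (real_inner_le_norm a b)
  have ha := rpow_nonneg (norm_nonneg a) (p - 2)
  have hb := rpow_nonneg (norm_nonneg b) (p - 2)
  have h2 := mul_nonneg (add_nonneg ha hb) hcs
  have h1 : 0 ≤ (‖a‖ - ‖b‖) * (‖a‖ ^ (p - 1) - ‖b‖ ^ (p - 1)) := by
    rcases le_total ‖a‖ ‖b‖ with h | h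
    · exact mul_nonneg_of_nonpos_of_nonpos (sub_nonpos.2 h)
        (sub_nonpos.2 (rpow_le_rpow (norm_nonneg _) h hp1.le))
    · exact mul_nonneg (sub_nonneg.2 h)
        (sub_nonneg.2 (rpow_le_rpow (norm_nonneg _) h hp1.le))
  refine ⟨hexp ▸ add_nonneg h1 h2, fun h0 => ?_⟩
  have hnorm : ‖a‖ = ‖b‖ := by
    rw [hexp] at h0
    rcases mul_eq_zero.1 (by linarith :
      (‖a‖ - ‖b‖) * (‖a‖ ^ (p - 1) - ‖b‖ ^ (p - 1)) = 0) with h | h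
    · linarith
    · exact (rpow_left_inj (norm_nonneg _) (norm_nonneg _) hp1.ne').1 (by linarith)
  rcases eq_or_ne b 0 with rfl | hb0
  · simpa using hnorm
  · rw [hnorm, ← smul_sub, inner_smul_right, real_inner_self_eq_norm_sq] at h0
    have : ‖b‖ ^ (p - 2) ≠ 0 := (rpow_pos_of_pos (norm_pos_iff.2 hb0) _).ne'
    simpa [this, sub_eq_zero] using h0

/-- Comparison principle for the `p`-Laplacian. -/
theorem le_of_pdiv_flux_le {N : ℕ} (hN : 1 ≤ N) {p : ℝ} (hp : 1 < p)
    {Ω : Set (EuclideanSpace ℝ (Fin N))} (hΩo : IsOpen Ω) (hΩb : Bornology.IsBounded Ω)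
    {u v : EuclideanSpace ℝ (Fin N) → ℝ}
    (huc : ContinuousOn u (closure Ω)) (hvc : ContinuousOn v (closure Ω))
    (hu : ContDiffOn ℝ 1 u Ω) (hv : ContDiffOn ℝ 1 v Ω)
    (hfu : ContDiffOn ℝ 1 (flux p u) Ω) (hfv : ContDiffOn ℝ 1 (flux p v) Ω)
    (hbd : ∀ x ∈ frontier Ω, u x ≤ v x)
    (hle : ∀ x ∈ Ω, pdiv (flux p v) x ≤ pdiv (flux p u) x) {x : EuclideanSpace ℝ (Fin N)}
    (hx : x ∈ Ω) : u x ≤ v x := by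
  by_contra! hlt
  obtain ⟨ε, hε, hεx⟩ : ∃ ε : ℝ, 0 < ε ∧ ε < u x - v x := exists_between (sub_pos.2 hlt)
  set K : Set (EuclideanSpace ℝ (Fin N)) := closure Ω ∩ (fun y => u y - v y) ⁻¹' Ici ε
  have hK : IsCompact K := hΩb.isCompact_closure.of_isClosed_subset
    ((huc.sub hvc).preimage_isClosed_of_isClosed isClosed_closure isClosed_Ici)
    inter_subset_left
  have hKΩ : K ⊆ Ω := fun y hy => by
    by_contra hyΩ
    have h1 := hbd y ⟨hy.1, by rwa [hΩo.interior_eq]⟩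
    have h2 : ε ≤ u y - v y := hy.2
    linarith
  set f : EuclideanSpace ℝ (Fin N) → ℝ := fun y => max (u y - v y - ε) 0 ^ 2 with hfdef
  set W : EuclideanSpace ℝ (Fin N) → EuclideanSpace ℝ (Fin N) :=
    fun y => flux p u y - flux p v y
  have hf : ContDiffOn ℝ 1 f Ω :=
    contDiff_max_zero_sq.comp_contDiffOn ((hu.sub hv).sub contDiffOn_const)
  have hW : ContDiffOn ℝ 1 W Ω := hfu.sub hfv
  have hf0 : ∀ y ∈ Ω, y ∉ K → f y = 0 := fun y hy hyK => by
    have : u y - v y < ε := by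
      by_contra! h
      exact hyK ⟨subset_closure hy, h⟩
    simp [hfdef, max_eq_right (by linarith : u y - v y - ε ≤ 0)]
  have hfder : ∀ y ∈ Ω, HasFDerivAt f
      ((2 * max (u y - v y - ε) 0) • InnerProductSpace.toDual ℝ _ (∇ u y - ∇ v y)) y := by
    intro y hy
    have hgu := (hu.differentiableOn one_ne_zero).hasGradientAt (hΩo.mem_nhds hy)
    have hgv := (hv.differentiableOn one_ne_zero).hasGradientAt (hΩo.mem_nhds hy)
    have := (hasDerivAt_max_zero_sq (u y - v y - ε)).comp_hasFDerivAt y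
      ((hgu.hasFDerivAt.sub hgv.hasFDerivAt).sub_const ε)
    rw [map_sub]
    exact this
  have hF := contDiff_indicator_of_eq_zero_off_compact (f := fun y => f y • W y) hΩo hK hKΩ
    (hf.smul hW) (fun y hy hyK => by simp [hf0 y hy hyK])
  have hFc : HasCompactSupport (Ω.indicator fun y => f y • W y) :=
    HasCompactSupport.intro hK fun y hy => by
      by_cases hyΩ : y ∈ Ω
      · simp [hyΩ, hf0 y hyΩ hy]
      · simp [hyΩ]
  have hdiv : ∀ y ∈ Ω, pdiv (Ω.indicator fun y => f y • W y) y =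
      2 * max (u y - v y - ε) 0 * inner ℝ (∇ u y - ∇ v y) (W y) +
        f y * (pdiv (flux p u) y - pdiv (flux p v) y) := by
    intro y hy
    have hyn := hΩo.mem_nhds hy
    have hdu := (hfu.contDiffAt hyn).differentiableAt one_ne_zero
    have hdv := (hfv.contDiffAt hyn).differentiableAt one_ne_zero
    rw [pdiv_congr_of_eventuallyEq (W := fun y => f y • W y)
        (by filter_upwards [hyn] with z hz using indicator_of_mem hz _),
      pdiv_smul (V := W) (hfder y hy).differentiableAt (hdu.sub hdv), (hfder y hy).fderiv,
      show pdiv W y = _ from pdiv_sub hdu hdv]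
    simp only [_root_.smul_apply, InnerProductSpace.toDual_apply_apply, smul_eq_mul]
  have hterm : ∀ y ∈ Ω, 0 ≤ 2 * max (u y - v y - ε) 0 * inner ℝ (∇ u y - ∇ v y) (W y) ∧
      0 ≤ f y * (pdiv (flux p u) y - pdiv (flux p v) y) := fun y hy =>
    ⟨mul_nonneg (by positivity) (inner_sub_norm_rpow_smul_sub hp _ _).1,
      mul_nonneg (sq_nonneg _) (sub_nonneg.2 (hle y hy))⟩
  have hnonneg : 0 ≤ pdiv (Ω.indicator fun y => f y • W y) := fun y => by
    by_cases hy : y ∈ Ω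
    · rw [hdiv y hy]
      exact add_nonneg (hterm y hy).1 (hterm y hy).2
    · rw [pdiv_congr_of_eventuallyEq (W := fun _ => 0)]
      · simp [pdiv]
      · filter_upwards [hK.isClosed.isOpen_compl.mem_nhds fun h => hy (hKΩ h)] with z hz
        by_cases hzΩ : z ∈ Ω
        · simp [hzΩ, hf0 z hzΩ hz]
        · simp [hzΩ]
  have hzero : ∀ y, pdiv (Ω.indicator fun y => f y • W y) y = 0 := fun y => by
    by_contra hy
    exact ((continuous_pdiv hF).integral_pos_of_hasCompactSupport_nonneg_nonzero (hasCompactSupport_pdiv hFc)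
      hnonneg hy (μ := volume)).ne' (integral_pdiv_eq_zero hF hFc)
  have hh := contDiff_indicator_of_eq_zero_off_compact hΩo hK hKΩ hf hf0
  have hhder : ∀ y, fderiv ℝ (Ω.indicator f) y = 0 := fun y => by
    by_cases hy : y ∈ Ω
    · have heq : Ω.indicator f =ᶠ[𝓝 y] f := by
        filter_upwards [hΩo.mem_nhds hy] with z hz using indicator_of_mem hz _
      rw [heq.fderiv_eq, (hfder y hy).fderiv]
      have h0 : 2 * max (u y - v y - ε) 0 * inner ℝ (∇ u y - ∇ v y) (W y) = 0 := by
        linarith [hzero y, hdiv y hy, (hterm y hy).1, (hterm y hy).2]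
      rcases mul_eq_zero.1 h0 with h | h
      · rw [h, zero_smul]
      · rw [(inner_sub_norm_rpow_smul_sub hp _ _).2 h, sub_self, map_zero, smul_zero]
    · have heq : Ω.indicator f =ᶠ[𝓝 y] fun _ => 0 := by
        filter_upwards [hK.isClosed.isOpen_compl.mem_nhds fun h => hy (hKΩ h)] with z hz
        by_cases hzΩ : z ∈ Ω
        · simp [hzΩ, hf0 z hzΩ hz]
        · simp [hzΩ]
      rw [heq.fderiv_eq]
      simp
  have : Nonempty (Fin N) := ⟨⟨0, hN⟩⟩
  obtain ⟨z, hz⟩ : ∃ z, z ∉ K := by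
    by_contra! h
    exact noncompact_univ (EuclideanSpace ℝ (Fin N)) (by rwa [← eq_univ_of_forall h])
  have hconst := is_const_of_fderiv_eq_zero (hh.differentiable one_ne_zero) hhder x z
  have hz0 : Ω.indicator f z = 0 := by
    by_cases hzΩ : z ∈ Ω
    · simp [hzΩ, hf0 z hzΩ hz]
    · simp [hzΩ]
  rw [hz0, indicator_of_mem hx] at hconst
  have : 0 < f x := pow_pos (lt_max_of_lt_left (by linarith)) 2
  exact this.ne' hconst

/-- The flux of the radial torsion profile is linear. -/
theorem flux_radial {N : ℕ} (hN : 1 ≤ N) {p : ℝ} (hp : 1 < p)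
    (x₁ : EuclideanSpace ℝ (Fin N)) (D : ℝ) :
    flux p (fun x => ((p - 1) / p) * (N : ℝ) ^ (-(1 / (p - 1))) *
      (D - ‖x - x₁‖ ^ (p / (p - 1)))) = fun x => -(N : ℝ)⁻¹ • (x - x₁) := by
  have hp1 : 0 < p - 1 := by linarith
  have hq : 1 < p / (p - 1) := by
    rw [one_lt_div hp1]
    linarith
  have hNpos : (0 : ℝ) < N := by exact_mod_cast hN
  ext1 x
  set k : ℝ := (N : ℝ) ^ (-(1 / (p - 1))) with hk
  have hkpos : 0 < k := rpow_pos_of_pos hNpos _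
  have hgrad : ∇ (fun x => ((p - 1) / p) * k * (D - ‖x - x₁‖ ^ (p / (p - 1)))) x =
      -(k * ‖x - x₁‖ ^ (p / (p - 1) - 2)) • (x - x₁) := by
    refine HasGradientAt.gradient ?_
    rw [hasGradientAt_iff_hasFDerivAt]
    have h := ((((hasFDerivAt_norm_rpow (x - x₁) hq).comp x
      ((hasFDerivAt_id x).sub_const x₁))).const_sub D).const_mul ((p - 1) / p * k)
    refine h.congr_fderiv ?_
    ext y
    simp
    field_simp
  rw [flux, hgrad]
  rcases eq_or_ne (x - x₁) 0 with h0 | h0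
  · simp [h0]
  · have hr : 0 < ‖x - x₁‖ := norm_pos_iff.2 h0
    set r := ‖x - x₁‖ with hrdef
    have hs : 0 < k * r ^ (p / (p - 1) - 2) := by positivity
    rw [norm_smul, norm_neg, Real.norm_of_nonneg hs.le, smul_smul]
    congr 1
    rw [← hrdef, mul_rpow hs.le hr.le, mul_rpow hkpos.le (by positivity), ← rpow_mul hr.le]
    have hkp : k ^ (p - 2) * k = (N : ℝ)⁻¹ := by
      rw [← rpow_add_one hkpos.ne', hk, ← rpow_mul hNpos.le, ← rpow_neg_one]
      congr 1
      field_simp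
      ring
    have hrp : r ^ ((p / (p - 1) - 2) * (p - 2)) * r ^ (p - 2) * r ^ (p / (p - 1) - 2) = 1 := by
      have hexp : (p / (p - 1) - 2) * (p - 2) + (p - 2) + (p / (p - 1) - 2) = 0 := by
        field_simp
        ring
      rw [← rpow_add hr, ← rpow_add hr, hexp, rpow_zero]
    linear_combination (-1 : ℝ) * (k ^ (p - 2) * k) * hrp - hkp

theorem pdiv_smul_sub_const {N : ℕ} (c : ℝ) (x₁ x : EuclideanSpace ℝ (Fin N)) :
    pdiv (fun y => c • (y - x₁)) x = N * c := by
  have h : HasFDerivAt (fun y => c • (y - x₁))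
      (c • ContinuousLinearMap.id ℝ (EuclideanSpace ℝ (Fin N))) x :=
    ((hasFDerivAt_id x).sub_const x₁).const_smul c
  simp [pdiv, h.fderiv]

/-- upper bound for the `p`-torsion function `ψ` of a bounded open set
`Ω` (i.e. `-Δ_p ψ = 1` in `Ω`, `ψ = 0` on `∂Ω`): if `Ω ⊆ B_d(x₁)` then for every
`x ∈ Ω`, `ψ(x) ≤ ((p-1)/p) N^(-1/(p-1)) (d^(p/(p-1)) - ‖x-x₁‖^(p/(p-1)))`, and in
particular `sup_Ω ψ ≤ ((p-1)/p) N^(-1/(p-1)) d^(p/(p-1))`. -/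
theorem stmt13 {N : ℕ} (hN : 1 ≤ N) (p : ℝ) (hp : 1 < p)
    (Ω : Set (EuclideanSpace ℝ (Fin N))) (hΩo : IsOpen Ω) (hΩb : Bornology.IsBounded Ω)
    (ψ : EuclideanSpace ℝ (Fin N) → ℝ)
    (hψc : ContinuousOn ψ (closure Ω)) (hψ1 : ContDiffOn ℝ 1 ψ Ω)
    (hψbd : ∀ x ∈ frontier Ω, ψ x = 0)
    (hψflux : ContDiffOn ℝ 1 (flux p ψ) Ω)
    (hψeq : ∀ x ∈ Ω, pdiv (flux p ψ) x = -1)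
    (x₁ : EuclideanSpace ℝ (Fin N)) (d : ℝ) (hd : 0 < d)
    (hsub : Ω ⊆ ball x₁ d) :
    (∀ x ∈ Ω, ψ x ≤ ((p - 1) / p) * (N : ℝ) ^ (-(1 / (p - 1))) *
      (d ^ (p / (p - 1)) - ‖x - x₁‖ ^ (p / (p - 1)))) ∧
    sSup (ψ '' Ω) ≤ ((p - 1) / p) * (N : ℝ) ^ (-(1 / (p - 1))) * d ^ (p / (p - 1)) := by
  have hp1 : 0 < p - 1 := by linarith
  have hq : 1 < p / (p - 1) := by
    rw [one_lt_div hp1]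
    linarith
  have hNpos : (0 : ℝ) < N := by exact_mod_cast hN
  have hC : 0 ≤ (p - 1) / p * (N : ℝ) ^ (-(1 / (p - 1))) := by positivity
  have hφ : ContDiff ℝ 1 fun x => ((p - 1) / p) * (N : ℝ) ^ (-(1 / (p - 1))) *
      (d ^ (p / (p - 1)) - ‖x - x₁‖ ^ (p / (p - 1))) :=
    contDiff_const.mul (contDiff_const.sub ((contDiff_id.sub contDiff_const).norm_rpow hq))
  have hmain : ∀ x ∈ Ω, ψ x ≤ ((p - 1) / p) * (N : ℝ) ^ (-(1 / (p - 1))) *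
      (d ^ (p / (p - 1)) - ‖x - x₁‖ ^ (p / (p - 1))) := by
    intro x hx
    refine le_of_pdiv_flux_le hN hp hΩo hΩb hψc hφ.continuous.continuousOn hψ1
      hφ.contDiffOn hψflux ?_ (fun y hy => ?_) (fun y hy => ?_) hx
    · rw [flux_radial hN hp]
      fun_prop
    · rw [hψbd y hy]
      have hyd : ‖y - x₁‖ ≤ d :=
        mem_closedBall_iff_norm.1 (closure_ball_subset_closedBall (closure_mono hsub hy.1))
      exact mul_nonneg hC
        (sub_nonneg.2 (rpow_le_rpow (norm_nonneg _) hyd (by linarith)))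
    · rw [flux_radial hN hp, pdiv_smul_sub_const, hψeq y hy, mul_neg,
        mul_inv_cancel₀ hNpos.ne']
  refine ⟨hmain, Real.sSup_le ?_ (by positivity)⟩
  rintro _ ⟨x, hx, rfl⟩
  refine (hmain x hx).trans (mul_le_mul_of_nonneg_left ?_ hC)
  linarith [rpow_nonneg (norm_nonneg (x - x₁)) (p / (p - 1))]
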